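/- Let 0 < ε ≤ 1/8, let z ∈ ℂ with |z| = 1, let l ∈ {1, 2}, and let s ∈ S⁵. (i) If z·B^l·s = s, then s ∈ U₁ \ ∂U₁. (ii) If z·A²B·s = s or z·A B²·s = s, then s ∈ U₂ \ ∂U₂. (That is, the fixed-point sets on S⁵ of the exceptional elements b^l z of G̃₃ lie in the interior of U₁, and those of the exceptional elements a²bz and ab²z lie in the interior of U₂.) -/

import Mathlib

open Matrix

noncomputable section

/-- `ξ = exp(2πi/3)`, a primitive cube root of unity. -/
def ξ : ℂ := Complex.exp (2 * Real.pi * Complex.I / 3)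

/-- The cyclic permutation matrix `A`, with rows `(0,1,0)`, `(0,0,1)`, `(1,0,0)`. -/
def A : Matrix (Fin 3) (Fin 3) ℂ := !![0, 1, 0; 0, 0, 1; 1, 0, 0]

/-- The diagonal matrix `B = diag(1, ξ, ξ²)`. -/
def B : Matrix (Fin 3) (Fin 3) ℂ := !![1, 0, 0; 0, ξ, 0; 0, 0, ξ ^ 2]

/-- The matrix `P = (1/√3)·[[1,ξ,1],[1,1,ξ],[ξ,1,1]]`. -/
def P : Matrix (Fin 3) (Fin 3) ℂ :=
  (((Real.sqrt 3 : ℝ) : ℂ))⁻¹ • !![1, ξ, 1; 1, 1, ξ; ξ, 1, 1]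

/-- Euclidean space `ℂ³`. -/
abbrev E3 := EuclideanSpace ℂ (Fin 3)

/-- Application of a `3 × 3` complex matrix to a vector in `ℂ³`. -/
def app (M : Matrix (Fin 3) (Fin 3) ℂ) (v : E3) : E3 := Matrix.toEuclideanLin M v

/-- The unit sphere `S⁵ ⊆ ℂ³`. -/
abbrev S5 : Set E3 := Metric.sphere (0 : E3) 1

/-- The subset `U₁ = {A^k v : k ∈ ℕ, ‖v‖ = 1, |v₂|² + |v₃|² ≤ ε}` of `S⁵`. -/
def U1 (ε : ℝ) : Set S5 :=
  {w | ∃ (k : ℕ) (v : E3), ‖v‖ = 1 ∧ ‖v 1‖ ^ 2 + ‖v 2‖ ^ 2 ≤ ε ∧ (w : E3) = app (A ^ k) v}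

/-- The subset `U₂ = P · U₁` of `S⁵`. -/
def U2 (ε : ℝ) : Set S5 := {w | ∃ u ∈ U1 ε, (w : E3) = app P (u : E3)}

theorem app_mul (M N : Matrix (Fin 3) (Fin 3) ℂ) (v : E3) : app (M * N) v = app M (app N v) := by
  simp [app, Matrix.toLpLin_apply, Matrix.mulVec_mulVec]

theorem app_one (v : E3) : app 1 v = v := by
  simp [app]

theorem app_apply (M : Matrix (Fin 3) (Fin 3) ℂ) (v : E3) (i : Fin 3) :
    app M v i = M i 0 * v 0 + M i 1 * v 1 + M i 2 * v 2 := by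
  simp [app, Matrix.toLpLin_apply, Matrix.mulVec, dotProduct, Fin.sum_univ_three]

theorem continuous_app (M : Matrix (Fin 3) (Fin 3) ℂ) : Continuous (app M) :=
  (Matrix.toEuclideanLin M).continuous_of_finiteDimensional

theorem norm_app {M : Matrix (Fin 3) (Fin 3) ℂ} (hM : Mᴴ * M = 1) (v : E3) : ‖app M v‖ = ‖v‖ := by
  have h : inner ℂ (app M v) (app M v) = inner ℂ v v := by
    simp only [EuclideanSpace.inner_eq_star_dotProduct, app, Matrix.toLpLin_apply,
      Matrix.star_mulVec]
    rw [dotProduct_comm, ← Matrix.dotProduct_mulVec, Matrix.mulVec_mulVec, hM, Matrix.one_mulVec,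
      dotProduct_comm]
  rw [inner_self_eq_norm_sq_to_K, inner_self_eq_norm_sq_to_K] at h
  exact (sq_eq_sq₀ (norm_nonneg _) (norm_nonneg _)).mp (by exact_mod_cast h)

theorem norm_sq_eq_add (v : E3) : ‖v‖ ^ 2 = ‖v 0‖ ^ 2 + ‖v 1‖ ^ 2 + ‖v 2‖ ^ 2 := by
  simp [EuclideanSpace.norm_sq_eq, Fin.sum_univ_three]

theorem isPrimitiveRoot_ξ : IsPrimitiveRoot ξ 3 := by
  simpa [ξ] using Complex.isPrimitiveRoot_exp 3 (by norm_num)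

theorem ξ_pow_three : ξ ^ 3 = 1 := isPrimitiveRoot_ξ.pow_eq_one

theorem ξ_sq_add : ξ ^ 2 + ξ + 1 = 0 := by
  have h := isPrimitiveRoot_ξ.geom_sum_eq_zero (by norm_num)
  simp only [Finset.sum_range_succ, Finset.sum_range_zero] at h
  linear_combination h

theorem star_ξ : (starRingEnd ℂ) ξ = ξ ^ 2 := by
  have h : ξ * (starRingEnd ℂ) ξ = 1 := by
    rw [Complex.mul_conj', isPrimitiveRoot_ξ.norm'_eq_one (by norm_num)]
    norm_num
  linear_combination ξ ^ 2 * h - (starRingEnd ℂ) ξ * ξ_pow_three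

theorem A_pow_three : A ^ 3 = 1 := by
  ext i j
  fin_cases i <;> fin_cases j <;> simp [A, pow_succ, Matrix.mul_apply, Fin.sum_univ_three]

theorem A_conjTranspose_mul : Aᴴ * A = 1 := by
  ext i j
  fin_cases i <;> fin_cases j <;> simp [A, Matrix.mul_apply, Fin.sum_univ_three]

theorem P_conjTranspose_mul : Pᴴ * P = 1 := by
  have h3 : (((Real.sqrt 3 : ℝ) : ℂ))⁻¹ * (((Real.sqrt 3 : ℝ) : ℂ))⁻¹ = 1 / 3 := by
    rw [← mul_inv, ← Complex.ofReal_mul, Real.mul_self_sqrt (by norm_num)]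
    norm_num
  rw [P, Matrix.conjTranspose_smul, Matrix.smul_mul, Matrix.mul_smul, smul_smul]
  simp only [star_inv₀, Complex.star_def, Complex.conj_ofReal]
  rw [h3]
  ext i j
  have h1 := ξ_sq_add
  have h2 := ξ_pow_three
  fin_cases i <;> fin_cases j <;>
    simp [Matrix.mul_apply, Fin.sum_univ_three, star_ξ] <;> grind

theorem A_sq_mul_B_mul_P : A ^ 2 * B * P = P * B := by
  have h := ξ_pow_three
  rw [P, Matrix.smul_mul, Matrix.mul_smul]
  congr 1
  ext i j
  fin_cases i <;> fin_cases j <;>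
    simp [A, B, pow_two, Matrix.mul_apply, Fin.sum_univ_three] <;> grind

theorem A_mul_B_sq_mul_P : A * B ^ 2 * P = P * (ξ ^ 2 • B ^ 2) := by
  have h := ξ_pow_three
  rw [P, Matrix.smul_mul, Matrix.mul_smul]
  congr 1
  ext i j
  fin_cases i <;> fin_cases j <;>
    simp [A, B, pow_two, Matrix.mul_apply, Fin.sum_univ_three] <;> grind

/-- The open set of unit vectors having some coordinate of squared modulus above `1 - ε`. -/
def dominantSet (ε : ℝ) : Set S5 := {w | ∃ i, 1 - ε < ‖(w : E3) i‖ ^ 2}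

theorem isOpen_dominantSet (ε : ℝ) : IsOpen (dominantSet ε) := by
  simp only [dominantSet, Set.ofPred_exists]
  refine isOpen_iUnion fun i => isOpen_lt continuous_const ?_
  fun_prop

theorem dominantSet_subset_U1 (ε : ℝ) : dominantSet ε ⊆ U1 ε := by
  rintro w ⟨i, hi⟩
  have hA (k : ℕ) (v : E3) : ‖app (A ^ k) v‖ = ‖v‖ := by
    induction k with
    | zero => simp [app_one]
    | succ k ih => rw [pow_succ', app_mul, norm_app A_conjTranspose_mul, ih]
  have h0 : app (A ^ (i : ℕ)) w 0 = (w : E3) i := by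
    fin_cases i <;> simp [app_apply, A, pow_two]
  have hv : ‖app (A ^ (i : ℕ)) w‖ = 1 := (hA _ _).trans (by simp)
  refine ⟨2 * i, app (A ^ (i : ℕ)) w, hv, ?_, ?_⟩
  · have := norm_sq_eq_add (app (A ^ (i : ℕ)) w)
    rw [hv, h0] at this
    linarith
  · rw [← app_mul, ← pow_add, show 2 * (i : ℕ) + i = 3 * i by ring, pow_mul, A_pow_three, one_pow,
      app_one]

theorem mem_dominantSet_of_fixed {ε : ℝ} (hε : 0 < ε) {l : ℕ} (hl : l = 1 ∨ l = 2) {z : ℂ}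
    (hz : z ≠ 0) {u : S5} (h : app (z • B ^ l) (u : E3) = u) : u ∈ dominantSet ε := by
  have hB (i : Fin 3) : z * ξ ^ (l * i) * (u : E3) i = (u : E3) i := by
    conv_rhs => rw [← h]
    rcases hl with rfl | rfl <;> fin_cases i <;>
      simp [app_apply, B, pow_two] <;> grind
  have hpair (i j : Fin 3) (hij : i ≠ j) : (u : E3) i = 0 ∨ (u : E3) j = 0 := by
    by_contra! hne
    have hi : z * ξ ^ (l * i) = 1 := mul_right_cancel₀ hne.1 (by simpa using hB i)
    have hj : z * ξ ^ (l * j) = 1 := mul_right_cancel₀ hne.2 (by simpa using hB j)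
    have hpow : (ξ ^ l) ^ (i : ℕ) = (ξ ^ l) ^ (j : ℕ) := by
      rw [← pow_mul, ← pow_mul]
      exact mul_left_cancel₀ hz (hi.trans hj.symm)
    have hprim : IsPrimitiveRoot (ξ ^ l) 3 :=
      isPrimitiveRoot_ξ.pow_of_coprime l (by rcases hl with rfl | rfl <;> norm_num)
    exact hij (Fin.ext (hprim.pow_inj i.2 j.2 hpow))
  have hsum := norm_sq_eq_add (u : E3)
  rw [norm_eq_of_mem_sphere] at hsum
  suffices ∃ i, ‖(u : E3) i‖ ^ 2 = 1 by
    obtain ⟨i, hi⟩ := this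
    exact ⟨i, by linarith⟩
  rcases hpair 0 1 (by decide) with h0 | h1
  · rcases hpair 1 2 (by decide) with h1 | h2
    · exact ⟨2, by simpa [h0, h1] using hsum.symm⟩
    · exact ⟨1, by simpa [h0, h2] using hsum.symm⟩
  · rcases hpair 0 2 (by decide) with h0 | h2
    · exact ⟨2, by simpa [h0, h1] using hsum.symm⟩
    · exact ⟨0, by simpa [h1, h2] using hsum.symm⟩

theorem mem_diff_frontier_of_mem_interior {X : Type*} [TopologicalSpace X] {x : X} {t : Set X}
    (h : x ∈ interior t) : x ∈ t \ frontier t :=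
  ⟨interior_subset h, fun hf => hf.2 h⟩

theorem mem_interior_U2_of_fixed {ε : ℝ} (hε : 0 < ε) {M : Matrix (Fin 3) (Fin 3) ℂ} {l : ℕ}
    (hl : l = 1 ∨ l = 2) {c z : ℂ} (hc : c ≠ 0) (hz : z ≠ 0) (hM : M * P = P * (c • B ^ l))
    {s : S5} (h : app (z • M) (s : E3) = s) : s ∈ interior (U2 ε) := by
  have hP : P * Pᴴ = 1 := mul_eq_one_comm.mp P_conjTranspose_mul
  have hPn (v : E3) : ‖app Pᴴ v‖ = ‖v‖ := norm_app (by simpa using hP) v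
  let f : S5 → S5 := fun w => ⟨app Pᴴ w, by simp [hPn]⟩
  have hf : Continuous f := ((continuous_app _).comp continuous_subtype_val).subtype_mk _
  refine mem_interior.mpr ⟨f ⁻¹' dominantSet ε, fun w hw => ⟨f w, dominantSet_subset_U1 ε hw, ?_⟩,
    (isOpen_dominantSet ε).preimage hf, ?_⟩
  · rw [← app_mul, hP, app_one]
  · refine mem_dominantSet_of_fixed hε hl (mul_ne_zero hz hc) ?_
    have hconj : (z * c) • B ^ l * Pᴴ = Pᴴ * (z • M) := by
      calc (z * c) • B ^ l * Pᴴ = Pᴴ * P * (z • (c • B ^ l)) * Pᴴ := by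
            rw [P_conjTranspose_mul, one_mul, smul_smul]
        _ = Pᴴ * (z • (M * P)) * Pᴴ := by rw [hM, mul_assoc Pᴴ, Matrix.mul_smul]
        _ = Pᴴ * (z • M) := by
            rw [← Matrix.smul_mul, mul_assoc, mul_assoc, hP, mul_one]
    change app _ (app Pᴴ s) = app Pᴴ s
    rw [← app_mul, hconj, app_mul, h]

/-- The fixed points on `S⁵` of the exceptional elements `z·b^l` lie in the interior of `U₁`,
and those of `z·a²b` and `z·ab²` lie in the interior of `U₂`. -/
theorem exceptional_fixed_points_in_interiors (ε : ℝ) (hε0 : 0 < ε) (hε : ε ≤ 1 / 8)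
    (z : ℂ) (hz : ‖z‖ = 1) (s : S5) :
    (∀ l : ℕ, (l = 1 ∨ l = 2) → app (z • B ^ l) (s : E3) = (s : E3) →
      s ∈ U1 ε \ frontier (U1 ε)) ∧
    (app (z • (A ^ 2 * B)) (s : E3) = (s : E3) → s ∈ U2 ε \ frontier (U2 ε)) ∧
    (app (z • (A * B ^ 2)) (s : E3) = (s : E3) → s ∈ U2 ε \ frontier (U2 ε)) := by
  have hz0 : z ≠ 0 := norm_pos_iff.mp (hz ▸ one_pos)
  have hξ : ξ ≠ 0 := isPrimitiveRoot_ξ.ne_zero (by norm_num)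
  refine ⟨fun l hl h => mem_diff_frontier_of_mem_interior ?_,
    fun h => mem_diff_frontier_of_mem_interior ?_, fun h => mem_diff_frontier_of_mem_interior ?_⟩
  · exact interior_maximal (dominantSet_subset_U1 ε) (isOpen_dominantSet ε)
      (mem_dominantSet_of_fixed hε0 hl hz0 h)
  · exact mem_interior_U2_of_fixed hε0 (Or.inl rfl) one_ne_zero hz0
      (by rw [pow_one, one_smul, A_sq_mul_B_mul_P]) h
  · exact mem_interior_U2_of_fixed hε0 (Or.inr rfl) (pow_ne_zero 2 hξ) hz0 A_mul_B_sq_mul_P h
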